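/- Let c = c^cr = 1/(4 log 2) and C₀ = −6/log(1 − c/2). For all constants C, C₁ with C₀ < C < C₁ and every K > 0, there exist a constant C₂ > 0 and N₀ such that for every integer N ≥ N₀, every integer k with C·log N ≤ k ≤ C₁·log N, every nondecreasing sequence 𝐀 = (A₁ ⊆ A₂ ⊆ … ⊆ A_k) of subsets of V_N with |A_k| ≤ K·N^{4/3}, every a ∈ V_N and every b ∈ V_N ∖ (A_k ∪ {a}): |Q(𝐀,k; a,b) − 1/N²| ≤ C₂·(log N)²/N^{7/3}. -/

import Mathlib

open scoped BigOperators

/-- Vertices of the discrete 2-dimensional torus. -/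
abbrev Vtx (N : ℕ) : Type := ZMod N × ZMod N

/-- `ρ_N(i)`: for a residue represented in `{0,…,N−1}`, `ρ_N(i) = i` if `i ≤ N/2`
and `ρ_N(i) = N − i` otherwise. -/
def rhoN (N : ℕ) (i : ZMod N) : ℕ :=
  if 2 * i.val ≤ N then i.val else N - i.val

/-- Torus distance `ρ(u,v) = ρ_N(u₁ − v₁) + ρ_N(u₂ − v₂)`. -/
def torusDist (N : ℕ) (u v : Vtx N) : ℕ :=
  rhoN N (u.1 - v.1) + rhoN N (u.2 - v.2)

/-- Connection probability `p(u,v) = min(c/(N·ρ(u,v)), 1)` for `u ≠ v`, `p(u,u) = 0`. -/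
noncomputable def edgeProb (N : ℕ) (c : ℝ) (u v : Vtx N) : ℝ :=
  if u = v then 0 else min (c / ((N : ℝ) * (torusDist N u v : ℝ))) 1

/-- The critical value `c^cr = 1/(4 log 2)`. -/
noncomputable def ccr : ℝ := 1 / (4 * Real.log 2)

/-- `Z_{N,A}(u) = Σ_{v ∈ V_N∖A, v ≠ u} p(u,v)`. -/
noncomputable def ZNA (N : ℕ) [NeZero N] (c : ℝ) (A : Finset (Vtx N)) (u : Vtx N) : ℝ :=
  ∑ v ∈ (Finset.univ \ A).erase u, edgeProb N c u v

/-- Transition kernel of the chain avoiding `A`: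
`P_A(u,v) = p(u,v)/Z_{N,A}(u)` for `v ∉ A`, and `0` for `v ∈ A`. -/
noncomputable def transPA (N : ℕ) [NeZero N] (c : ℝ) (A : Finset (Vtx N))
    (u v : Vtx N) : ℝ :=
  if v ∈ A then 0 else edgeProb N c u v / ZNA N c A u

/-- Auxiliary recursion for the memory-walk kernel: `memQ i m H x b` is the sum over
paths of `m` further steps, starting from `x` at time `i` with history `H`, where the
`i`-th step uses the kernel `P_{A_i ∪ H}` (which vanishes on targets in `A_i ∪ H`). -/
noncomputable def memQ (N : ℕ) [NeZero N] (c : ℝ) (A : ℕ → Finset (Vtx N)) :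
    ℕ → ℕ → Finset (Vtx N) → Vtx N → Vtx N → ℝ
  | _, 0, _, x, b => if x = b then 1 else 0
  | i, m + 1, H, x, b =>
      ∑ y : Vtx N, transPA N c (A i ∪ H) x y * memQ N c A (i + 1) m (insert y H) y b

/-- The `k`-step memory-walk kernel `Q(𝐀,k;a,b)`: the sum over all tuples
`(u₂,…,u_k)` with `u_i ∉ A_{i−1} ∪ {a,u₂,…,u_{i−1}}` of
`P_{A₁∪{a}}(a,u₂)·P_{A₂∪{a,u₂}}(u₂,u₃)·…·P_{A_k∪{a,u₂,…,u_k}}(u_k,b)`. -/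
noncomputable def kernelQ (N : ℕ) [NeZero N] (c : ℝ) (A : ℕ → Finset (Vtx N))
    (k : ℕ) (a b : Vtx N) : ℝ :=
  memQ N c A 1 k {a} a b


section AbstractPart

variable {V : Type*} [Fintype V] [DecidableEq V]

theorem mpow_nonneg (P : Matrix V V ℝ) (h0 : ∀ x y, 0 ≤ P x y) (m : ℕ) :
    ∀ x y, 0 ≤ (P ^ m) x y := by
  induction m with
  | zero => intro x y; rw [pow_zero, Matrix.one_apply]; split_ifs <;> norm_num
  | succ m ih =>
    intro x y
    rw [pow_succ, Matrix.mul_apply]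
    exact Finset.sum_nonneg fun z _ => mul_nonneg (ih _ _) (h0 _ _)

theorem mpow_row (P : Matrix V V ℝ) (h1 : ∀ x, ∑ y, P x y = 1) (m : ℕ) :
    ∀ x, ∑ y, (P ^ m) x y = 1 := by
  induction m with
  | zero => intro x; simp [Matrix.one_apply]
  | succ m ih =>
    intro x
    simp_rw [pow_succ, Matrix.mul_apply]
    rw [Finset.sum_comm]
    simp_rw [← Finset.mul_sum, h1, mul_one, ih]

theorem mpow_le (P : Matrix V V ℝ) (h0 : ∀ x y, 0 ≤ P x y) (h1 : ∀ x, ∑ y, P x y = 1)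
    (L : ℝ) (hL : ∀ x y, (P ^ 2) x y ≤ L) (m : ℕ) (hm : 2 ≤ m) (x y : V) :
    (P ^ m) x y ≤ L := by
  obtain ⟨j, rfl⟩ := Nat.exists_eq_add_of_le' hm
  rw [pow_add, Matrix.mul_apply]
  calc ∑ z, (P ^ j) x z * (P ^ 2) z y ≤ ∑ z, (P ^ j) x z * L :=
        Finset.sum_le_sum fun z _ => mul_le_mul_of_nonneg_left (hL _ _) (mpow_nonneg P h0 j _ _)
    _ = L := by rw [← Finset.sum_mul, mpow_row P h1, one_mul]

theorem mpow_mix (P : Matrix V V ℝ) (h0 : ∀ x y, 0 ≤ P x y) (h1 : ∀ x, ∑ y, P x y = 1)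
    (hs : ∀ x y, P x y = P y x) (hd : ∀ x, P x x = 0) (n : ℝ) (hn : n = Fintype.card V)
    (hn1 : 1 ≤ n) (α : ℝ) (hα : 0 ≤ α) (hP : ∀ x y, x ≠ y → α / n ≤ P x y) (m : ℕ) (a : V) :
    ∑ b, |(P ^ m) a b - 1 / n| ≤ 2 * (1 - α + 2 * α / n) ^ m := by
  have hn0 : (0:ℝ) < n := by linarith
  have hcard : ∑ _b : V, (1 / n) = 1 := by
    rw [Finset.sum_const, Finset.card_univ, nsmul_eq_mul, ← hn]; field_simp
  have hrow : ∀ y, ∑ b, |P y b - α / n| ≤ 1 - α + 2 * α / n := by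
    intro y
    calc ∑ b, |P y b - α / n| ≤ ∑ b, (P y b - α * (1 / n) + if y = b then 2 * α / n else 0) := by
          apply Finset.sum_le_sum
          intro b _
          by_cases h : y = b
          · subst h
            have : 0 ≤ α / n := by positivity
            rw [hd, if_pos rfl, zero_sub, abs_neg, abs_of_nonneg this]
            apply le_of_eq; ring
          · rw [if_neg h, abs_of_nonneg (by linarith [hP y b h])]
            apply le_of_eq; ring
      _ = _ := by
          rw [Finset.sum_add_distrib, Finset.sum_sub_distrib, ← Finset.mul_sum, hcard, h1]
          simp
  induction m with
  | zero =>
    simp only [pow_zero, mul_one]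
    calc ∑ b, |(1 : Matrix V V ℝ) a b - 1 / n| ≤ ∑ b, ((1 : Matrix V V ℝ) a b + 1 / n) := by
          apply Finset.sum_le_sum
          intro b _
          have h2 : 0 ≤ (1 : Matrix V V ℝ) a b := by
            rw [Matrix.one_apply]; split_ifs <;> norm_num
          have h3 : 0 ≤ 1 / n := by positivity
          rw [abs_le]; constructor <;> linarith
      _ = 2 := by
          rw [Finset.sum_add_distrib, hcard]; simp [Matrix.one_apply]; norm_num
  | succ m ih =>
    have hθ : 0 ≤ 1 - α + 2 * α / n := le_trans (Finset.sum_nonneg fun b _ => abs_nonneg _) (hrow a)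
    have hz : ∑ y, ((P ^ m) a y - 1 / n) = 0 := by
      rw [Finset.sum_sub_distrib, mpow_row P h1, hcard, sub_self]
    have key : ∀ b, (P ^ (m + 1)) a b - 1 / n = ∑ y, ((P ^ m) a y - 1 / n) * (P y b - α / n) := by
      intro b
      have hc : ∑ y, P y b = 1 := by simp_rw [fun y => hs y b]; exact h1 b
      simp_rw [mul_sub]
      rw [Finset.sum_sub_distrib, ← Finset.sum_mul, hz, zero_mul, sub_zero]
      simp_rw [sub_mul]
      rw [Finset.sum_sub_distrib, ← Finset.mul_sum, hc, pow_succ, Matrix.mul_apply, mul_one]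
    calc ∑ b, |(P ^ (m + 1)) a b - 1 / n|
        ≤ ∑ b, ∑ y, |(P ^ m) a y - 1 / n| * |P y b - α / n| := by
          apply Finset.sum_le_sum
          intro b _
          rw [key]
          refine (Finset.abs_sum_le_sum_abs _ _).trans (le_of_eq ?_)
          simp_rw [abs_mul]
      _ = ∑ y, |(P ^ m) a y - 1 / n| * ∑ b, |P y b - α / n| := by
          rw [Finset.sum_comm]; simp_rw [Finset.mul_sum]
      _ ≤ ∑ y, |(P ^ m) a y - 1 / n| * (1 - α + 2 * α / n) :=
          Finset.sum_le_sum fun y _ => mul_le_mul_of_nonneg_left (hrow y) (abs_nonneg _)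
      _ = (∑ y, |(P ^ m) a y - 1 / n|) * (1 - α + 2 * α / n) := by rw [Finset.sum_mul]
      _ ≤ (2 * (1 - α + 2 * α / n) ^ m) * (1 - α + 2 * α / n) :=
          mul_le_mul_of_nonneg_right ih hθ
      _ = _ := by ring

end AbstractPart

theorem memQ_nonneg (N : ℕ) [NeZero N] (c : ℝ) (A : ℕ → Finset (Vtx N))
    (hT : ∀ S x y, 0 ≤ transPA N c S x y) (m : ℕ) :
    ∀ i H x b, 0 ≤ memQ N c A i m H x b := by
  induction m with
  | zero => intro i H x b; rw [memQ]; split_ifs <;> norm_num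
  | succ m ih =>
    intro i H x b
    rw [memQ]
    exact Finset.sum_nonneg fun y _ => mul_nonneg (hT _ _ _) (ih _ _ _ _)

theorem memQ_upper (N : ℕ) [NeZero N] (c : ℝ) (A : ℕ → Finset (Vtx N))
    (P : Matrix (Vtx N) (Vtx N) ℝ) (h0 : ∀ x y, 0 ≤ P x y) (M q : ℝ) (hq : 0 ≤ q)
    (hT : ∀ S x y, 0 ≤ transPA N c S x y)
    (hU : ∀ S : Finset (Vtx N), (S.card : ℝ) ≤ M → ∀ x y, transPA N c S x y ≤ q * P x y)
    (k : ℕ) (B : Finset (Vtx N)) (hB : ∀ i, 1 ≤ i → i ≤ k → A i ⊆ B) (b : Vtx N) (m : ℕ) :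
    ∀ i H x, 1 ≤ i → i + m ≤ k + 1 → (B.card : ℝ) + H.card + m ≤ M →
      memQ N c A i m H x b ≤ q ^ m * (P ^ m) x b := by
  induction m with
  | zero => intro i H x _ _ _; rw [memQ]; simp [Matrix.one_apply]
  | succ m ih =>
    intro i H x hi him hM
    rw [memQ, pow_succ' P, Matrix.mul_apply, Finset.mul_sum]
    apply Finset.sum_le_sum
    intro y _
    have hcard : ((A i ∪ H).card : ℝ) ≤ M := by
      have h1 : (A i ∪ H).card ≤ B.card + H.card :=
        (Finset.card_union_le _ _).trans
          (Nat.add_le_add_right (Finset.card_le_card (hB i hi (by omega))) _)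
      have h2 : ((A i ∪ H).card : ℝ) ≤ B.card + H.card := by exact_mod_cast h1
      push_cast at hM
      have : (0:ℝ) ≤ m := Nat.cast_nonneg m
      linarith
    have hH : ((insert y H).card : ℝ) ≤ H.card + 1 := by
      exact_mod_cast Finset.card_insert_le y H
    have := ih (i + 1) (insert y H) y (by omega) (by omega) (by push_cast at hM; linarith)
    calc _ ≤ (q * P x y) * (q ^ m * (P ^ m) y b) :=
          mul_le_mul (hU _ hcard _ _) this (memQ_nonneg N c A hT _ _ _ _ _)
            (mul_nonneg hq (h0 _ _))
      _ = _ := by ring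

theorem memQ_lower (N : ℕ) [NeZero N] (c : ℝ) (A : ℕ → Finset (Vtx N))
    (P : Matrix (Vtx N) (Vtx N) ℝ) (h0 : ∀ x y, 0 ≤ P x y) (h1 : ∀ x, ∑ y, P x y = 1)
    (hd : ∀ x, P x x = 0)
    (M δ L : ℝ) (hL0 : 0 ≤ L) (hδ0 : 0 ≤ δ)
    (hL : ∀ x y, (P ^ 2) x y ≤ L)
    (hδ : ∀ S : Finset (Vtx N), (S.card : ℝ) ≤ M → ∀ x, ∑ y ∈ S, P x y ≤ δ)
    (hδ1 : ∀ x y, P x y ≤ δ)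
    (hT : ∀ S x y, 0 ≤ transPA N c S x y)
    (hU : ∀ S : Finset (Vtx N), (S.card : ℝ) ≤ M → ∀ x y, y ∉ S → P x y ≤ transPA N c S x y)
    (k : ℕ) (B : Finset (Vtx N)) (hB : ∀ i, 1 ≤ i → i ≤ k → A i ⊆ B) (b : Vtx N)
    (hbB : b ∉ B) (m : ℕ) :
    ∀ i H x, 1 ≤ i → i + (m + 2) ≤ k + 1 → (B.card : ℝ) + H.card + m + 3 ≤ M → b ∉ H →
      (P ^ (m + 2)) x b - m * (2 * δ * L) - ∑ y ∈ B ∪ H, (P ^ (m + 1)) x y * P y b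
        ≤ memQ N c A i (m + 2) H x b := by
  have hcardu : ∀ i H, 1 ≤ i → i ≤ k → ((A i ∪ H).card : ℝ) ≤ B.card + H.card := by
    intro i H hi hik
    have h1 : (A i ∪ H).card ≤ B.card + H.card :=
        (Finset.card_union_le _ _).trans
          (Nat.add_le_add_right (Finset.card_le_card (hB i hi hik)) _)
    exact_mod_cast h1
  have hins : ∀ y (H : Finset (Vtx N)), ((insert y H).card : ℝ) ≤ H.card + 1 := fun y H => by
      exact_mod_cast Finset.card_insert_le y H
  have hstep : ∀ i H x m, 1 ≤ i → i ≤ k → (B.card : ℝ) + H.card ≤ M → ∀ S, B ∪ H ⊆ S →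
      ∑ y ∈ Sᶜ, P x y * memQ N c A (i + 1) m (insert y H) y b ≤
        memQ N c A i (m + 1) H x b := by
    intro i H x m hi hik hM S hS
    rw [memQ]
    calc _ ≤ ∑ y ∈ Sᶜ, transPA N c (A i ∪ H) x y * memQ N c A (i + 1) m (insert y H) y b := by
          apply Finset.sum_le_sum
          intro y hy
          apply mul_le_mul_of_nonneg_right _ (memQ_nonneg N c A hT _ _ _ _ _)
          apply hU _ ((hcardu i H hi hik).trans hM)
          intro hyA
          rw [Finset.mem_compl] at hy
          exact hy (hS (Finset.union_subset_union_left (hB i hi hik) hyA))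
      _ ≤ _ := Finset.sum_le_univ_sum_of_nonneg fun y =>
          mul_nonneg (hT _ _ _) (memQ_nonneg N c A hT _ _ _ _ _)
  induction m with
  | zero =>
    intro i H x hi hik hM hbH
    push_cast at hM
    have hone : ∀ y, P y b ≤ memQ N c A (i + 1) 1 (insert y H) y b := by
      intro y
      by_cases hyb : y = b
      · subst hyb; rw [hd]; exact memQ_nonneg N c A hT _ _ _ _ _
      · rw [memQ]
        simp only [memQ, mul_ite, mul_one, mul_zero]
        rw [Finset.sum_ite_eq' Finset.univ b, if_pos (Finset.mem_univ _)]
        apply hU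
        · have := hcardu (i+1) (insert y H) (by omega) (by omega)
          have := hins y H
          linarith
        · simp only [Finset.mem_union, Finset.mem_insert, not_or]
          exact ⟨fun h => hbB (hB _ (by omega) (by omega) h), fun h => hyb h.symm, hbH⟩
    have h2 := hstep i H x 1 hi (by omega) (by linarith) _ (subset_refl _)
    have h3 : ∑ y ∈ (B ∪ H)ᶜ, P x y * P y b ≤
        ∑ y ∈ (B ∪ H)ᶜ, P x y * memQ N c A (i + 1) 1 (insert y H) y b :=
      Finset.sum_le_sum fun y _ => mul_le_mul_of_nonneg_left (hone y) (h0 _ _)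
    have h4 := Finset.sum_add_sum_compl (B ∪ H) (fun y => P x y * P y b)
    have h5 : (P ^ (0 + 2)) x b = ∑ y, P x y * P y b := by
      rw [zero_add, pow_two, Matrix.mul_apply]
    rw [h5]
    simp only [zero_add, pow_one, Nat.cast_zero, zero_mul]
    linarith
  | succ m ih =>
    intro i H x hi hik hM hbH
    push_cast at hM
    have hm0 : (0:ℝ) ≤ m := Nat.cast_nonneg m
    set S := insert b (B ∪ H) with hSdef
    have hSc : (S.card : ℝ) ≤ M := by
      have e1 := hins b (B ∪ H)
      have e2 : ((B ∪ H).card : ℝ) ≤ B.card + H.card := by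
        exact_mod_cast Finset.card_union_le B H
      linarith
    have h2 := hstep i H x (m + 2) hi (by omega) (by linarith) S (Finset.subset_insert _ _)
    refine le_trans ?_ h2
    have hret : ∀ y, (P ^ (m + 1)) y y * P y b ≤ δ * L := by
      intro y
      rcases Nat.eq_zero_or_pos m with rfl | hm
      · rw [zero_add, pow_one, hd, zero_mul]; positivity
      · have := mpow_le P h0 h1 L hL (m + 1) (by omega) y y
        calc _ ≤ L * δ := mul_le_mul this (hδ1 _ _) (h0 _ _) hL0
          _ = _ := by ring
    have hb1 : ∀ y ∈ Sᶜ, P x y * ((P ^ (m + 2)) y b - (m * (2 * δ * L) + δ * L)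
          - ∑ z ∈ B ∪ H, (P ^ (m + 1)) y z * P z b) ≤
        P x y * memQ N c A (i + 1) (m + 2) (insert y H) y b := by
      intro y hy
      apply mul_le_mul_of_nonneg_left _ (h0 _ _)
      rw [Finset.mem_compl, hSdef, Finset.mem_insert, not_or] at hy
      have e := ih (i + 1) (insert y H) y (by omega) (by omega)
        (by have := hins y H; linarith)
        (by simp only [Finset.mem_insert, not_or]; exact ⟨fun h => hy.1 h.symm, hbH⟩)
      refine le_trans ?_ e
      rw [Finset.union_insert, Finset.sum_insert hy.2]
      linarith [hret y]
    refine le_trans ?_ (Finset.sum_le_sum hb1)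
    have hsplit := Finset.sum_add_sum_compl S (fun y => P x y * (P ^ (m + 2)) y b)
    have hA : ∑ y ∈ S, P x y * (P ^ (m + 2)) y b ≤ δ * L := by
      calc _ ≤ ∑ y ∈ S, P x y * L := Finset.sum_le_sum fun y _ =>
            mul_le_mul_of_nonneg_left (mpow_le P h0 h1 L hL (m + 2) (by omega) y b) (h0 _ _)
        _ = (∑ y ∈ S, P x y) * L := by rw [Finset.sum_mul]
        _ ≤ _ := mul_le_mul_of_nonneg_right (hδ S hSc x) hL0
    have hBc : ∑ y ∈ Sᶜ, P x y * (m * (2 * δ * L) + δ * L) ≤ m * (2 * δ * L) + δ * L := by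
      rw [← Finset.sum_mul]
      have : ∑ y ∈ Sᶜ, P x y ≤ 1 := by
        rw [← h1 x]; exact Finset.sum_le_univ_sum_of_nonneg fun y => h0 _ _
      have h5 : 0 ≤ (m * (2 * δ * L) + δ * L) := by positivity
      nlinarith
    have hCc : ∑ y ∈ Sᶜ, P x y * ∑ z ∈ B ∪ H, (P ^ (m + 1)) y z * P z b ≤
        ∑ z ∈ B ∪ H, (P ^ (m + 2)) x z * P z b := by
      calc _ ≤ ∑ y, P x y * ∑ z ∈ B ∪ H, (P ^ (m + 1)) y z * P z b :=
            Finset.sum_le_univ_sum_of_nonneg fun y => mul_nonneg (h0 _ _)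
              (Finset.sum_nonneg fun z _ => mul_nonneg (mpow_nonneg P h0 _ _ _) (h0 _ _))
        _ = _ := by
            simp_rw [Finset.mul_sum]
            rw [Finset.sum_comm]
            apply Finset.sum_congr rfl
            intro z _
            rw [pow_succ' P (m + 1), Matrix.mul_apply, Finset.sum_mul]
            exact Finset.sum_congr rfl fun y _ => by ring
    have hp : (P ^ (m + 1 + 2)) x b = ∑ y, P x y * (P ^ (m + 2)) y b := by
      rw [show m + 1 + 2 = (m + 2) + 1 by ring, pow_succ', Matrix.mul_apply]
    rw [hp, show m + 1 + 1 = m + 2 by ring]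
    simp_rw [mul_sub]
    rw [Finset.sum_sub_distrib, Finset.sum_sub_distrib]
    push_cast
    linarith

theorem rhoN_zero (N : ℕ) [NeZero N] : rhoN N 0 = 0 := by simp [rhoN]

theorem rhoN_neg (N : ℕ) [NeZero N] (i : ZMod N) : rhoN N (-i) = rhoN N i := by
  by_cases h : i = 0
  · subst h; simp
  · have : NeZero i := ⟨h⟩
    have h1 := ZMod.val_neg_of_ne_zero i
    have h2 := ZMod.val_lt i
    have h3 : i.val ≠ 0 := by rwa [Ne, ZMod.val_eq_zero]
    unfold rhoN
    rw [h1]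
    split_ifs <;> omega

theorem rhoN_eq_zero (N : ℕ) [NeZero N] (i : ZMod N) (h : rhoN N i = 0) : i = 0 := by
  have h2 := ZMod.val_lt i
  rw [← ZMod.val_eq_zero]
  unfold rhoN at h
  split_ifs at h <;> omega

theorem rhoN_le (N : ℕ) [NeZero N] (i : ZMod N) : 2 * rhoN N i ≤ N := by
  have h2 := ZMod.val_lt i
  unfold rhoN
  split_ifs <;> omega

/-- Fibre bound weight. -/
def wt (s : ℕ) : ℕ := if s = 0 then 1 else 2

theorem rhoN_fibre (N : ℕ) [NeZero N] (s : ℕ) :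
    (Finset.univ.filter fun i : ZMod N => rhoN N i = s).card ≤ wt s := by
  unfold wt
  split_ifs with h
  · subst h
    rw [Finset.card_le_one]
    intro a ha b hb
    simp only [Finset.mem_filter, Finset.mem_univ, true_and] at ha hb
    rw [rhoN_eq_zero N a ha, rhoN_eq_zero N b hb]
  · calc _ ≤ ({(s : ZMod N), -(s : ZMod N)} : Finset (ZMod N)).card := by
          apply Finset.card_le_card
          intro i hi
          simp only [Finset.mem_filter, Finset.mem_univ, true_and] at hi
          simp only [Finset.mem_insert, Finset.mem_singleton]
          have h2 := ZMod.val_lt i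
          unfold rhoN at hi
          split_ifs at hi
          · left; rw [← hi]; simp
          · right
            rw [← hi, Nat.cast_sub h2.le]; simp
      _ ≤ 2 := Finset.card_le_two

theorem shell_card (N : ℕ) [NeZero N] (r : ℕ) (hr : 1 ≤ r) :
    (Finset.univ.filter fun v : Vtx N => rhoN N v.1 + rhoN N v.2 = r).card ≤ 4 * r := by
  have hsub : (Finset.univ.filter fun v : Vtx N => rhoN N v.1 + rhoN N v.2 = r) ⊆
      (Finset.range (r + 1)).biUnion fun s =>
        (Finset.univ.filter fun i : ZMod N => rhoN N i = s) ×ˢ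
        (Finset.univ.filter fun i : ZMod N => rhoN N i = r - s) := by
    intro v hv
    simp only [Finset.mem_filter, Finset.mem_univ, true_and] at hv
    simp only [Finset.mem_biUnion, Finset.mem_range, Finset.mem_product, Finset.mem_filter,
      Finset.mem_univ, true_and]
    exact ⟨rhoN N v.1, by omega, rfl, by omega⟩
  refine (Finset.card_le_card hsub).trans (Finset.card_biUnion_le.trans ?_)
  calc _ ≤ ∑ s ∈ Finset.range (r + 1), wt s * wt (r - s) := by
        apply Finset.sum_le_sum
        intro s _
        rw [Finset.card_product]
        exact Nat.mul_le_mul (rhoN_fibre N _) (rhoN_fibre N _)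
    _ = 4 * r := by
        obtain ⟨t, rfl⟩ := Nat.exists_eq_add_of_le' hr
        rw [Finset.sum_range_succ, Finset.sum_range_succ']
        have : ∑ s ∈ Finset.range t, wt (s + 1) * wt (t + 1 - (s + 1)) = ∑ s ∈ Finset.range t, 4 := by
          apply Finset.sum_congr rfl
          intro s hs
          rw [Finset.mem_range] at hs
          unfold wt
          rw [if_neg (by omega), if_neg (by omega)]
        rw [this]
        simp [wt]
        ring

theorem torusDist_comm (N : ℕ) [NeZero N] (u v : Vtx N) : torusDist N u v = torusDist N v u := by
  unfold torusDist
  rw [← rhoN_neg N (u.1 - v.1), ← rhoN_neg N (u.2 - v.2), neg_sub, neg_sub]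

theorem torusDist_pos (N : ℕ) [NeZero N] (u v : Vtx N) (h : u ≠ v) : 1 ≤ torusDist N u v := by
  by_contra h1
  apply h
  unfold torusDist at h1
  have e1 := rhoN_eq_zero N (u.1 - v.1) (by omega)
  have e2 := rhoN_eq_zero N (u.2 - v.2) (by omega)
  exact Prod.ext (sub_eq_zero.mp e1) (sub_eq_zero.mp e2)

theorem torusDist_le (N : ℕ) [NeZero N] (u v : Vtx N) : torusDist N u v ≤ N := by
  unfold torusDist
  have := rhoN_le N (u.1 - v.1)
  have := rhoN_le N (u.2 - v.2)
  omega

theorem sum_radial_le (N : ℕ) [NeZero N] (g : ℕ → ℝ) (hg : ∀ r, 0 ≤ g r) (u : Vtx N) :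
    ∑ v, (if u = v then 0 else g (torusDist N u v)) ≤ ∑ r ∈ Finset.Icc 1 N, 4 * (r : ℝ) * g r := by
  have e : ∑ v, (if u = v then 0 else g (torusDist N u v)) =
      ∑ v ∈ Finset.univ.filter (fun v => ¬ u = v), g (torusDist N u v) := by
    rw [Finset.sum_filter]
    apply Finset.sum_congr rfl; intro v _; by_cases h : u = v <;> simp [h]
  rw [e, ← Finset.sum_fiberwise_of_maps_to (t := Finset.Icc 1 N) (g := fun v => torusDist N u v)]
  · apply Finset.sum_le_sum
    intro r hr
    rw [Finset.mem_Icc] at hr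
    have : ∑ v ∈ (Finset.univ.filter (fun v => ¬ u = v)).filter (fun v => torusDist N u v = r),
        g (torusDist N u v) = ∑ v ∈ (Finset.univ.filter (fun v => ¬ u = v)).filter
          (fun v => torusDist N u v = r), g r := by
      apply Finset.sum_congr rfl
      intro v hv
      rw [(Finset.mem_filter.mp hv).2]
    rw [this, Finset.sum_const, nsmul_eq_mul]
    apply mul_le_mul_of_nonneg_right _ (hg r)
    have h1 := shell_card N r hr.1
    have h2 : ((Finset.univ.filter (fun v => ¬ u = v)).filter
        (fun v => torusDist N u v = r)).card ≤
        (Finset.univ.filter fun v : Vtx N => rhoN N v.1 + rhoN N v.2 = r).card := by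
      apply Finset.card_le_card_of_injOn (fun v => u - v)
      · intro v hv
        have hv' := (Finset.mem_filter.mp hv).2
        simp only [Finset.coe_filter, Finset.mem_univ, true_and, Set.mem_ofPred_eq]
        exact hv'
      · intro v _ w _ h
        simpa using h
    exact_mod_cast h2.trans h1
  · intro v hv
    have hv' := (Finset.mem_filter.mp hv).2
    rw [Finset.mem_Icc]
    exact ⟨torusDist_pos N u v hv', torusDist_le N u v⟩

theorem ccr_pos : 0 < ccr := by
  unfold ccr; have := Real.log_two_gt_d9; positivity

theorem ccr_lt : ccr < 2 / 5 := by
  unfold ccr; have := Real.log_two_gt_d9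
  rw [div_lt_div_iff₀ (by positivity) (by norm_num)]; linarith

theorem edgeProb_eq (N : ℕ) [NeZero N] (u v : Vtx N) :
    edgeProb N ccr u v = ccr / N * (if u = v then 0 else 1 / (torusDist N u v : ℝ)) := by
  unfold edgeProb
  split_ifs with h
  · simp
  · have h1 : (1:ℝ) ≤ torusDist N u v := by exact_mod_cast torusDist_pos N u v h
    have h2 : (1:ℝ) ≤ N := by exact_mod_cast NeZero.one_le
    have := ccr_lt
    rw [min_eq_left]
    · field_simp
    · rw [div_le_one (by positivity)]; nlinarith

theorem edgeProb_nonneg (N : ℕ) [NeZero N] (u v : Vtx N) : 0 ≤ edgeProb N ccr u v := by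
  rw [edgeProb_eq]
  have := ccr_pos
  split_ifs <;> positivity

theorem edgeProb_self (N : ℕ) [NeZero N] (u : Vtx N) : edgeProb N ccr u u = 0 := by
  simp [edgeProb]

theorem edgeProb_comm (N : ℕ) [NeZero N] (u v : Vtx N) :
    edgeProb N ccr u v = edgeProb N ccr v u := by
  rw [edgeProb_eq, edgeProb_eq, torusDist_comm]; simp only [eq_comm]

theorem edgeProb_ge (N : ℕ) [NeZero N] (u v : Vtx N) (h : u ≠ v) :
    ccr / (N : ℝ) ^ 2 ≤ edgeProb N ccr u v := by
  rw [edgeProb_eq, if_neg h]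
  have := ccr_pos
  have h2 : (1:ℝ) ≤ N := by exact_mod_cast NeZero.one_le
  have h1 : (1:ℝ) ≤ torusDist N u v := by exact_mod_cast torusDist_pos N u v h
  have h3 : (torusDist N u v : ℝ) ≤ N := by exact_mod_cast torusDist_le N u v
  rw [div_mul_div_comm, mul_one, pow_two]
  gcongr

/-- total mass -/
noncomputable def Ztot (N : ℕ) [NeZero N] : ℝ := ∑ v, edgeProb N ccr 0 v

theorem sum_edgeProb (N : ℕ) [NeZero N] (u : Vtx N) : ∑ v, edgeProb N ccr u v = Ztot N := by
  unfold Ztot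
  symm
  apply Fintype.sum_equiv (Equiv.addRight u)
  intro v
  simp only [edgeProb, torusDist, Equiv.coe_addRight, Prod.fst_add, Prod.snd_add]
  have : (u = v + u) ↔ (0 = v) := by
    constructor
    · intro h; have h2 : v = 0 := by simpa using h
      exact h2.symm
    · intro h; simp [← h]
  simp [this]

theorem card_Vtx (N : ℕ) [NeZero N] : Fintype.card (Vtx N) = N ^ 2 := by
  simp [ZMod.card, pow_two]

theorem Ztot_le (N : ℕ) [NeZero N] : Ztot N ≤ 4 * ccr := by
  unfold Ztot
  have h2 : (1:ℝ) ≤ N := by exact_mod_cast NeZero.one_le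
  have hc := ccr_pos
  simp_rw [edgeProb_eq]
  rw [← Finset.mul_sum]
  have := sum_radial_le N (fun r => 1 / (r:ℝ)) (fun r => by positivity) 0
  have e : ∑ r ∈ Finset.Icc 1 N, 4 * (r : ℝ) * (1 / r) = 4 * N := by
    rw [Finset.sum_congr rfl (g := fun _ => (4:ℝ))]
    · simp; ring
    · intro r hr
      have : (r:ℝ) ≠ 0 := by
        have := (Finset.mem_Icc.mp hr).1
        positivity
      field_simp
  rw [e] at this
  calc _ ≤ ccr / N * (4 * N) := mul_le_mul_of_nonneg_left this (by positivity)
    _ = _ := by field_simp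

theorem Ztot_ge (N : ℕ) [NeZero N] (hN : 2 ≤ N) : ccr / 2 ≤ Ztot N := by
  unfold Ztot
  have h2 : (2:ℝ) ≤ N := by exact_mod_cast hN
  have hc := ccr_pos
  have : ∑ v : Vtx N, (ccr / (N:ℝ)^2 - if (0 : Vtx N) = v then ccr / (N:ℝ)^2 else 0) ≤
      ∑ v, edgeProb N ccr 0 v := by
    apply Finset.sum_le_sum
    intro v _
    by_cases h : (0 : Vtx N) = v
    · rw [if_pos h, sub_self]; exact edgeProb_nonneg N _ _
    · rw [if_neg h, sub_zero]; exact edgeProb_ge N _ _ h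
  refine le_trans ?_ this
  rw [Finset.sum_sub_distrib, Finset.sum_const, Finset.card_univ, card_Vtx, nsmul_eq_mul,
    Finset.sum_ite_eq, if_pos (Finset.mem_univ _)]
  push_cast
  have : ccr / (N:ℝ)^2 ≤ ccr / 2 := by gcongr; nlinarith
  have : (N:ℝ)^2 * (ccr / (N:ℝ)^2) = ccr := by field_simp
  linarith

/-- reference chain -/
noncomputable def Pm (N : ℕ) [NeZero N] : Matrix (Vtx N) (Vtx N) ℝ :=
  fun x y => edgeProb N ccr x y / Ztot N

theorem Pm_sum_le (N : ℕ) [NeZero N] (hN : 2 ≤ N) (S : Finset (Vtx N)) (M R : ℝ) (hR : 0 < R)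
    (hS : (S.card : ℝ) ≤ M) (x : Vtx N) : ∑ y ∈ S, Pm N x y ≤ 2 / N * (4 * R + M / R) := by
  have hZ := Ztot_ge N hN
  have hc := ccr_pos
  have h2 : (2:ℝ) ≤ N := by exact_mod_cast hN
  unfold Pm
  rw [← Finset.sum_div, div_le_iff₀ (by linarith)]
  have hrad := sum_radial_le N (fun r => if (r:ℝ) ≤ R then 1 / (r:ℝ) else 0)
    (fun r => by split_ifs <;> positivity) x
  have hrad2 : ∑ r ∈ Finset.Icc 1 N, 4 * (r : ℝ) * (if (r:ℝ) ≤ R then 1 / (r:ℝ) else 0) ≤ 4 * R := by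
    calc _ ≤ ∑ r ∈ Finset.Icc 1 N, (if r ≤ ⌊R⌋₊ then (4:ℝ) else 0) := by
          apply Finset.sum_le_sum
          intro r hr
          have hr1 := (Finset.mem_Icc.mp hr).1
          have : (r:ℝ) ≠ 0 := by positivity
          by_cases h : (r:ℝ) ≤ R
          · rw [if_pos h, if_pos (Nat.le_floor h)]; apply le_of_eq; field_simp
          · rw [if_neg h]; split_ifs <;> simp
      _ = ∑ r ∈ (Finset.Icc 1 N).filter (fun r => r ≤ ⌊R⌋₊), (4:ℝ) := by rw [Finset.sum_filter]
      _ ≤ ∑ r ∈ Finset.Icc 1 ⌊R⌋₊, (4:ℝ) := by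
          apply Finset.sum_le_sum_of_subset_of_nonneg
          · intro r hr
            simp only [Finset.mem_filter, Finset.mem_Icc] at hr ⊢
            exact ⟨hr.1.1, hr.2⟩
          · intros; norm_num
      _ = 4 * (⌊R⌋₊ : ℝ) := by simp; ring
      _ ≤ 4 * R := by have := Nat.floor_le hR.le; linarith
  have hpt : ∑ y ∈ S, (if x = y then 0 else 1 / (torusDist N x y : ℝ)) ≤ 4 * R + M / R := by
    calc _ ≤ ∑ y ∈ S, ((if x = y then 0 else
            (if (torusDist N x y:ℝ) ≤ R then 1 / (torusDist N x y:ℝ) else 0)) + 1 / R) := by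
          apply Finset.sum_le_sum
          intro y _
          by_cases h : x = y
          · rw [if_pos h, if_pos h]; positivity
          · rw [if_neg h, if_neg h]
            by_cases h' : (torusDist N x y:ℝ) ≤ R
            · rw [if_pos h']; have : 0 ≤ 1 / R := by positivity
              linarith
            · rw [if_neg h', zero_add]; push Not at h'
              exact one_div_le_one_div_of_le hR h'.le
      _ = ∑ y ∈ S, (if x = y then 0 else
            (if (torusDist N x y:ℝ) ≤ R then 1 / (torusDist N x y:ℝ) else 0)) + S.card / R := by
          rw [Finset.sum_add_distrib, Finset.sum_const, nsmul_eq_mul, mul_one_div]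
      _ ≤ _ := by
          apply add_le_add
          · refine le_trans (Finset.sum_le_univ_sum_of_nonneg fun y => ?_) (hrad.trans hrad2)
            split_ifs <;> positivity
          · gcongr
  simp_rw [edgeProb_eq]
  rw [← Finset.mul_sum]
  have hM : 0 ≤ M := le_trans (Nat.cast_nonneg _) hS
  calc _ ≤ ccr / N * (4 * R + M / R) := mul_le_mul_of_nonneg_left hpt (by positivity)
    _ = 2 / N * (4 * R + M / R) * (ccr / 2) := by ring
    _ ≤ _ := mul_le_mul_of_nonneg_left hZ (by positivity)

theorem Pm_sq_le (N : ℕ) [NeZero N] (hN : 2 ≤ N) (x b : Vtx N) :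
    ((Pm N) ^ 2) x b ≤ 16 * (1 + Real.log N) / (N : ℝ) ^ 2 := by
  have hZ := Ztot_ge N hN
  have hc := ccr_pos
  have h2 : (2:ℝ) ≤ N := by exact_mod_cast hN
  have hZ0 : 0 < Ztot N := by linarith
  have hsq : ∀ u : Vtx N, ∑ v, edgeProb N ccr u v ^ 2 ≤
      ccr ^ 2 / (N:ℝ)^2 * (4 * (1 + Real.log N)) := by
    intro u
    have := sum_radial_le N (fun r => (1 / (r:ℝ)) ^ 2) (fun r => by positivity) u
    have e : ∑ r ∈ Finset.Icc 1 N, 4 * (r : ℝ) * (1 / (r:ℝ)) ^ 2 ≤ 4 * (1 + Real.log N) := by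
      have hh := harmonic_le_one_add_log N
      rw [harmonic_eq_sum_Icc] at hh
      push_cast at hh
      refine le_trans (le_of_eq ?_) (mul_le_mul_of_nonneg_left hh (by norm_num))
      rw [Finset.mul_sum]
      apply Finset.sum_congr rfl
      intro r hr
      have hr1 := (Finset.mem_Icc.mp hr).1
      have : (r:ℝ) ≠ 0 := by positivity
      field_simp
    have e2 : ∀ v, edgeProb N ccr u v ^ 2 =
        ccr ^ 2 / (N:ℝ)^2 * (if u = v then 0 else (1 / (torusDist N u v : ℝ)) ^ 2) := by
      intro v
      rw [edgeProb_eq]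
      split_ifs
      · simp
      · ring
    simp_rw [e2]
    rw [← Finset.mul_sum]
    exact mul_le_mul_of_nonneg_left (this.trans e) (by positivity)
  rw [pow_two, Matrix.mul_apply]
  have h1 : ∑ y, Pm N x y * Pm N y b ≤
      (1/2 * (∑ y, edgeProb N ccr x y ^ 2) + 1/2 * (∑ y, edgeProb N ccr b y ^ 2)) / Ztot N ^ 2 := by
    rw [Finset.mul_sum, Finset.mul_sum, ← Finset.sum_add_distrib, Finset.sum_div]
    apply Finset.sum_le_sum
    intro y _
    unfold Pm
    rw [div_mul_div_comm, ← pow_two, edgeProb_comm N y b]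
    gcongr
    nlinarith [sq_nonneg (edgeProb N ccr x y - edgeProb N ccr b y)]
  refine h1.trans ?_
  have hlog : 0 ≤ Real.log N := Real.log_nonneg (by linarith)
  rw [div_le_iff₀ (by positivity)]
  calc _ ≤ ccr ^ 2 / (N:ℝ)^2 * (4 * (1 + Real.log N)) := by linarith [hsq x, hsq b]
    _ = 16 * (1 + Real.log N) / (N : ℝ) ^ 2 * (ccr / 2) ^ 2 := by ring
    _ ≤ _ := by gcongr

theorem ZNA_eq (N : ℕ) [NeZero N] (S : Finset (Vtx N)) (x : Vtx N) :
    ZNA N ccr S x = Ztot N - ∑ v ∈ S, edgeProb N ccr x v := by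
  unfold ZNA
  rw [Finset.sum_erase _ (edgeProb_self N x), ← sum_edgeProb N x, eq_sub_iff_add_eq]
  exact Finset.sum_sdiff (Finset.subset_univ S)

theorem transPA_nonneg (N : ℕ) [NeZero N] (S : Finset (Vtx N)) (x y : Vtx N) :
    0 ≤ transPA N ccr S x y := by
  unfold transPA ZNA
  split_ifs
  · exact le_rfl
  · exact div_nonneg (edgeProb_nonneg _ _ _) (Finset.sum_nonneg fun v _ => edgeProb_nonneg _ _ _)

theorem core_bound (N : ℕ) [NeZero N] (hN : 2 ≤ N) (M δ : ℝ) (hδ0 : 0 ≤ δ) (hM1 : 1 ≤ M)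
    (hδ : ∀ S : Finset (Vtx N), (S.card : ℝ) ≤ M → ∀ x, ∑ y ∈ S, Pm N x y ≤ δ)
    (k : ℕ) (hk3 : 3 ≤ k) (hkδ : k * δ ≤ 1 / 2) (L : ℝ) (hLdef : L = 16 * (1 + Real.log N) / (N : ℝ) ^ 2)
    (A : ℕ → Finset (Vtx N)) (hA : ∀ i j : ℕ, 1 ≤ i → i ≤ j → j ≤ k → A i ⊆ A j)
    (hcard : ((A k).card : ℝ) + k + 2 ≤ M) (a b : Vtx N) (hb : b ∉ A k) (hba : b ≠ a) :
    |kernelQ N ccr A k a b - 1 / (N : ℝ) ^ 2| ≤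
      3 * k * δ * L + 2 * (3 / 4 + 1 / 2 / (N : ℝ) ^ 2) ^ k := by
  have hZ := Ztot_ge N hN
  have hZ' := Ztot_le N
  have hc := ccr_pos
  have h2 : (2:ℝ) ≤ N := by exact_mod_cast hN
  have hZ0 : 0 < Ztot N := by linarith
  have hlog : 0 ≤ Real.log N := Real.log_nonneg (by linarith)
  have hk : 2 ≤ k := by omega
  have hk2 : (2:ℝ) ≤ k := by exact_mod_cast hk
  have hδ4 : δ ≤ 1 / 4 := by nlinarith
  have hL0 : 0 ≤ L := by rw [hLdef]; positivity
  have h0 : ∀ x y, 0 ≤ Pm N x y := fun x y => div_nonneg (edgeProb_nonneg N x y) hZ0.le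
  have h1 : ∀ x, ∑ y, Pm N x y = 1 := fun x => by
    unfold Pm; rw [← Finset.sum_div, sum_edgeProb, div_self hZ0.ne']
  have hs : ∀ x y, Pm N x y = Pm N y x := fun x y => by unfold Pm; rw [edgeProb_comm]
  have hd : ∀ x, Pm N x x = 0 := fun x => by unfold Pm; rw [edgeProb_self, zero_div]
  have hL : ∀ x y, ((Pm N) ^ 2) x y ≤ L := fun x y => by rw [hLdef]; exact Pm_sq_le N hN x y
  have hδ1 : ∀ x y, Pm N x y ≤ δ := fun x y => by
    have := hδ {y} (by simpa using hM1) x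
    simpa using this
  have hmin : ∀ x y, x ≠ y → (1/4) / (N:ℝ)^2 ≤ Pm N x y := fun x y h => by
    unfold Pm
    have := edgeProb_ge N x y h
    rw [le_div_iff₀ hZ0]
    calc _ ≤ (1/4) / (N:ℝ)^2 * (4 * ccr) := mul_le_mul_of_nonneg_left hZ' (by positivity)
      _ = ccr / (N:ℝ)^2 := by ring
      _ ≤ _ := this
  have hmix : |((Pm N) ^ k) a b - 1 / (N:ℝ)^2| ≤ 2 * (3 / 4 + 1 / 2 / (N : ℝ) ^ 2) ^ k := by
    have := mpow_mix (Pm N) h0 h1 hs hd ((N:ℝ)^2) (by rw [card_Vtx]; push_cast; rfl)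
      (by nlinarith) (1/4) (by norm_num) hmin k a
    have e : (1:ℝ) - 1/4 + 2 * (1/4) / (N:ℝ)^2 = 3 / 4 + 1 / 2 / (N : ℝ) ^ 2 := by ring
    rw [e] at this
    exact le_trans (Finset.single_le_sum (f := fun b => |((Pm N) ^ k) a b - 1 / (N:ℝ)^2|)
      (fun b _ => abs_nonneg _) (Finset.mem_univ b)) this
  have hZlow : ∀ S : Finset (Vtx N), (S.card : ℝ) ≤ M → ∀ x,
      Ztot N * (1 - δ) ≤ ZNA N ccr S x := fun S hS x => by
    have := hδ S hS x
    unfold Pm at this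
    rw [← Finset.sum_div, div_le_iff₀ hZ0] at this
    rw [ZNA_eq]; linarith
  have hZup : ∀ S x, ZNA N ccr S x ≤ Ztot N := fun S x => by
    rw [ZNA_eq]
    have : 0 ≤ ∑ v ∈ S, edgeProb N ccr x v := Finset.sum_nonneg fun v _ => edgeProb_nonneg N x v
    linarith
  have hpos : 0 < Ztot N * (1 - δ) := mul_pos hZ0 (by linarith)
  have hTlow : ∀ S : Finset (Vtx N), (S.card : ℝ) ≤ M → ∀ x y, y ∉ S →
      Pm N x y ≤ transPA N ccr S x y := fun S hS x y hy => by
    unfold Pm transPA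
    rw [if_neg hy]
    exact div_le_div_of_nonneg_left (edgeProb_nonneg N x y) (hpos.trans_le (hZlow S hS x)) (hZup S x)
  have hTup : ∀ S : Finset (Vtx N), (S.card : ℝ) ≤ M → ∀ x y,
      transPA N ccr S x y ≤ (1 - δ)⁻¹ * Pm N x y := fun S hS x y => by
    have hq : 0 ≤ (1 - δ)⁻¹ := inv_nonneg.mpr (by linarith)
    by_cases hy : y ∈ S
    · unfold transPA; rw [if_pos hy]; exact mul_nonneg hq (h0 x y)
    · have e : (1 - δ)⁻¹ * Pm N x y = edgeProb N ccr x y / (Ztot N * (1 - δ)) := by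
        unfold Pm; rw [div_mul_eq_div_div, div_eq_mul_inv _ (1 - δ), mul_comm]
      rw [e]
      unfold transPA
      rw [if_neg hy]
      exact div_le_div_of_nonneg_left (edgeProb_nonneg N x y) hpos (hZlow S hS x)
  have hB : ∀ i, 1 ≤ i → i ≤ k → A i ⊆ A k := fun i hi hik => hA i k hi hik le_rfl
  have hPk := mpow_le (Pm N) h0 h1 L hL k hk a b
  have hup : kernelQ N ccr A k a b ≤ ((Pm N) ^ k) a b + 3 * k * δ * L := by
    have hu := memQ_upper N ccr A (Pm N) h0 M (1 - δ)⁻¹ (inv_nonneg.mpr (by linarith))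
      (transPA_nonneg N) hTup k (A k) hB b k 1 {a} a le_rfl (by omega)
      (by rw [Finset.card_singleton]; push_cast; linarith)
    unfold kernelQ
    refine hu.trans ?_
    have hq : ((1 - δ)⁻¹) ^ k ≤ 1 + 2 * (k * δ) := by
      rw [inv_pow]
      have hb := one_add_mul_le_pow (a := -δ) (by linarith) k
      have hkδ0 : 0 ≤ k * δ := by positivity
      have e : (1:ℝ) + -δ = 1 - δ := by ring
      rw [e] at hb
      rw [inv_le_comm₀ (pow_pos (by linarith) k) (by positivity)]
      refine le_trans ?_ hb
      rw [inv_le_iff_one_le_mul₀ (by positivity)]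
      nlinarith
    have hp0 := mpow_nonneg (Pm N) h0 k a b
    have hkδ0 : 0 ≤ k * δ := by positivity
    calc _ ≤ (1 + 2 * (k * δ)) * ((Pm N) ^ k) a b := mul_le_mul_of_nonneg_right hq hp0
      _ ≤ _ := by nlinarith [mul_le_mul_of_nonneg_left hPk hkδ0, mul_nonneg hkδ0 hL0]
  have hlow : ((Pm N) ^ k) a b - 3 * k * δ * L ≤ kernelQ N ccr A k a b := by
    obtain ⟨m, rfl⟩ := Nat.exists_eq_add_of_le' hk
    push_cast at hcard
    have hl := memQ_lower N ccr A (Pm N) h0 h1 hd M δ L hL0 hδ0 hL hδ hδ1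
      (transPA_nonneg N) hTlow (m + 2) (A (m + 2)) hB b hb m 1 {a} a le_rfl (by omega)
      (by rw [Finset.card_singleton]; push_cast; linarith) (by simpa using hba)
    unfold kernelQ
    refine le_trans ?_ hl
    have hS : ((A (m+2) ∪ {a}).card : ℝ) ≤ M := by
      have : ((A (m+2) ∪ {a}).card : ℝ) ≤ (A (m+2)).card + 1 := by
        exact_mod_cast Finset.card_union_le (A (m+2)) {a}
      have : (0:ℝ) ≤ m := Nat.cast_nonneg m
      linarith
    have hD : ∑ y ∈ A (m+2) ∪ {a}, ((Pm N) ^ (m + 1)) a y * Pm N y b ≤ δ * L := by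
      calc _ ≤ ∑ y ∈ A (m+2) ∪ {a}, L * Pm N b y := by
            apply Finset.sum_le_sum
            intro y _
            rw [hs y b]
            exact mul_le_mul_of_nonneg_right (mpow_le _ h0 h1 L hL _ (by omega) _ _) (h0 _ _)
        _ = L * ∑ y ∈ A (m+2) ∪ {a}, Pm N b y := by rw [Finset.mul_sum]
        _ ≤ L * δ := mul_le_mul_of_nonneg_left (hδ _ hS b) hL0
        _ = _ := by ring
    have : 0 ≤ δ * L := by positivity
    push_cast
    nlinarith
  have := abs_le.mp hmix
  rw [abs_le]
  constructor <;> linarith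

set_option maxHeartbeats 2000000

/-- Let `c = c^cr` and `C₀ = −6/log(1 − c/2)`. For all constants `C₀ < C < C₁` and
`K > 0` there are `C₂ > 0` and `N₀` such that for every `N ≥ N₀`, every
`C·log N ≤ k ≤ C₁·log N`, every nondecreasing sequence `𝐀 = (A₁ ⊆ … ⊆ A_k)` with
`|A_k| ≤ K·N^{4/3}`, every `a ∈ V_N` and every `b ∈ V_N ∖ (A_k ∪ {a})`:
`|Q(𝐀,k;a,b) − 1/N²| ≤ C₂·(log N)²/N^{7/3}`. -/
theorem stmt16 (C C₁ : ℝ) (hC0 : -6 / Real.log (1 - ccr / 2) < C) (hCC : C < C₁)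
    (K : ℝ) (hK : 0 < K) :
    ∃ C₂ : ℝ, 0 < C₂ ∧ ∃ N₀ : ℕ, ∀ (N : ℕ) [NeZero N], N₀ ≤ N →
      ∀ k : ℕ, C * Real.log N ≤ (k : ℝ) → (k : ℝ) ≤ C₁ * Real.log N →
        ∀ A : ℕ → Finset (Vtx N),
          (∀ i j : ℕ, 1 ≤ i → i ≤ j → j ≤ k → A i ⊆ A j) →
          ((A k).card : ℝ) ≤ K * (N : ℝ) ^ ((4 : ℝ) / 3) →
          ∀ a b : Vtx N, b ∉ A k → b ≠ a →
            |kernelQ N ccr A k a b - 1 / (N : ℝ) ^ 2| ≤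
              C₂ * (Real.log N) ^ 2 / (N : ℝ) ^ ((7 : ℝ) / 3) := by

  have hc := ccr_pos
  have hc' := ccr_lt
  set lam := Real.log (1 - ccr / 2) with hlam
  have hlam0 : lam < 0 := Real.log_neg (by linarith) (by linarith)
  have hClam : C * lam < -6 := by
    rw [div_lt_iff_of_neg hlam0] at hC0; exact hC0
  have hC : 0 < C := lt_trans (div_pos_of_neg_of_neg (by norm_num) hlam0) hC0
  have hC1 : 0 < C₁ := hC.trans hCC
  refine ⟨192 * C₁ * (K + 5) + 2, by positivity, ?_⟩
  have hε : 0 < 1 / (4 * C₁ * (K + 5)) := by positivity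
  have ev1 : ∀ᶠ n : ℕ in Filter.atTop,
      Real.log n ≤ 1 / (4 * C₁ * (K + 5)) * (n : ℝ) ^ ((1:ℝ) / 3) := by
    have := (isLittleO_log_rpow_atTop (r := (1:ℝ)/3) (by norm_num)).bound hε
    have h2 := tendsto_natCast_atTop_atTop (R := ℝ) |>.eventually this
    filter_upwards [h2] with n hn
    rw [Real.norm_eq_abs, Real.norm_eq_abs, abs_of_nonneg (a := (n:ℝ) ^ ((1:ℝ) / 3)) (by positivity)] at hn
    exact (le_abs_self _).trans hn
  have ev2 : ∀ᶠ n : ℕ in Filter.atTop, 3 / C ≤ Real.log n :=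
    (Real.tendsto_log_atTop.comp tendsto_natCast_atTop_atTop).eventually_ge_atTop _
  obtain ⟨N₀, hN₀⟩ := Filter.eventually_atTop.mp
    (ev1.and (ev2.and (Filter.eventually_ge_atTop 8)))
  refine ⟨N₀, ?_⟩
  intro N _ hN k hk1 hk2 A hA hAc a b hb hba
  obtain ⟨hE1, hE2, hE3⟩ := hN₀ N hN
  have hN8 : (8:ℝ) ≤ N := by exact_mod_cast hE3
  have hNp : (0:ℝ) < N := by linarith
  set t := (N:ℝ) ^ ((1:ℝ) / 3) with ht
  have htp : 0 < t := by positivity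
  have ht3 : t ^ 3 = N := by
    rw [ht, ← Real.rpow_natCast, ← Real.rpow_mul hNp.le]; norm_num
  have ht2 : 2 ≤ t := by
    by_contra h
    push Not at h
    have : t ^ 3 < 2 ^ 3 := pow_lt_pow_left₀ h htp.le (by norm_num)
    linarith
  have hN43 : (N:ℝ) ^ ((4:ℝ) / 3) = t ^ 4 := by
    rw [ht, ← Real.rpow_natCast, ← Real.rpow_mul hNp.le]; norm_num
  have hN73 : (N:ℝ) ^ ((7:ℝ) / 3) = t ^ 7 := by
    rw [ht, ← Real.rpow_natCast, ← Real.rpow_mul hNp.le]; norm_num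
  rw [hN43] at hAc
  rw [hN73]
  set l := Real.log N with hl
  have hl1 : 1 ≤ l := by
    rw [hl, Real.le_log_iff_exp_le hNp]
    have := Real.exp_one_lt_d9
    linarith
  have hk3 : 3 ≤ k := by
    have : (3:ℝ) ≤ k := by
      rw [div_le_iff₀ hC] at hE2
      linarith
    exact_mod_cast this
  have hKl : C₁ * l * (4 * (K + 5)) ≤ t := by
    have : 1 / (4 * C₁ * (K + 5)) * t = t / (4 * C₁ * (K + 5)) := by ring
    rw [this, le_div_iff₀ (by positivity)] at hE1
    linarith
  have hkt : (k:ℝ) * (4 * (K + 5)) ≤ t := le_trans (by gcongr) hKl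
  have hk0 : (0:ℝ) ≤ k := Nat.cast_nonneg k
  have hkt' : (k:ℝ) ≤ t := by nlinarith
  have ht4 : t + 2 ≤ t ^ 4 := by
    have h4 : (2:ℝ) ^ 3 ≤ t ^ 3 := pow_le_pow_left₀ (by norm_num) ht2 3
    nlinarith
  have hcore := core_bound N (by omega) ((K + 1) * t ^ 4) (2 * (K + 5) / t) (by positivity)
    (by nlinarith) (by
      intro S hS x
      refine (Pm_sum_le N (by omega) S _ (t ^ 2) (by positivity) hS x).trans (le_of_eq ?_)
      rw [← ht3]; field_simp; ring)
    k hk3 (by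
      rw [mul_div_assoc', div_le_iff₀ htp]; linarith)
    _ rfl A hA (by nlinarith) a b hb hba
  refine hcore.trans ?_
  have hθ : (3 / 4 + 1 / 2 / (N : ℝ) ^ 2) ^ k ≤ 1 / t ^ 7 := by
    have e1 : 3 / 4 + 1 / 2 / (N : ℝ) ^ 2 ≤ 1 - ccr / 2 := by
      have : 1 / 2 / (N : ℝ) ^ 2 ≤ 1 / 20 := by
        rw [div_le_iff₀ (by positivity)]; nlinarith
      linarith
    calc _ ≤ (1 - ccr / 2) ^ k := pow_le_pow_left₀ (by positivity) e1 k
      _ = Real.exp (k * lam) := by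
          rw [hlam, mul_comm, Real.exp_mul, Real.exp_log (by linarith), Real.rpow_natCast]
      _ ≤ Real.exp (-(6 * l)) := by
          apply Real.exp_le_exp.mpr
          nlinarith
      _ = 1 / (N:ℝ) ^ 6 := by
          rw [Real.exp_neg, one_div, hl, mul_comm, Real.exp_mul, Real.exp_log hNp]
          norm_cast
      _ = 1 / t ^ 18 := by rw [← ht3]; ring
      _ ≤ 1 / t ^ 7 := by
          apply one_div_le_one_div_of_le (by positivity)
          exact pow_le_pow_right₀ (by linarith) (by norm_num)
  have hmain : 3 * k * (2 * (K + 5) / t) * (16 * (1 + l) / (N:ℝ) ^ 2) ≤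
      192 * C₁ * (K + 5) * l ^ 2 / t ^ 7 := by
    calc _ ≤ 3 * (C₁ * l) * (2 * (K + 5) / t) * (16 * (l + l) / (N:ℝ) ^ 2) := by gcongr
      _ = _ := by rw [← ht3]; field_simp; ring
  have h2 : 2 * (1 / t ^ 7) ≤ 2 * l ^ 2 / t ^ 7 := by
    rw [mul_one_div]
    exact div_le_div_of_nonneg_right (by nlinarith) (by positivity)
  calc _ ≤ 192 * C₁ * (K + 5) * l ^ 2 / t ^ 7 + 2 * l ^ 2 / t ^ 7 := by linarith
    _ = _ := by ring
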